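/- arXiv:0709.1339 — 2 statements merged into one kernel-verified Lean document; each statement's English description precedes it below -/
import Mathlib

section
/- Let k = (k₁, k₂) ∈ ℝ², η ∈ (0, 1], and define f(x, x_d) := (−(k·x_d)·x⁽²⁾, (k·x_d)·(x⁽¹⁾ − 1/2) − x⁽²⁾/2), g(x) := √η·(2x⁽¹⁾(x⁽¹⁾ − 1), (2x⁽¹⁾ − 1)x⁽²⁾), and Ψ(x) := x⁽¹⁾(x⁽¹⁾ − 1) + (x⁽²⁾)² for x = (x⁽¹⁾, x⁽²⁾) ∈ ℝ². Then for every x ∈ ℝ² with Ψ(x) = 0 and every x_d ∈ ℝ²: ∇Ψ(x)ᵀ f(x, x_d) + ‖g(x)‖² ≤ 0. -/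
/-- The derivative of `p ↦ p.1 * (p.1 - 1) + p.2 ^ 2` at `x`, applied to `v`. -/
lemma fderiv_circle_apply (x v : ℝ × ℝ) :
    fderiv ℝ (fun p : ℝ × ℝ => p.1 * (p.1 - 1) + p.2 ^ 2) x v =
      (2 * x.1 - 1) * v.1 + 2 * x.2 * v.2 := by
  have h1 : HasFDerivAt (fun p : ℝ × ℝ => p.1) (ContinuousLinearMap.fst ℝ ℝ ℝ) x :=
    hasFDerivAt_fst
  have h2 : HasFDerivAt (fun p : ℝ × ℝ => p.2) (ContinuousLinearMap.snd ℝ ℝ ℝ) x :=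
    hasFDerivAt_snd
  have h : HasFDerivAt (fun p : ℝ × ℝ => p.1 * (p.1 - 1) + p.2 ^ 2) _ x :=
    (h1.mul (h1.sub_const 1)).add (h2.pow 2)
  rw [h.fderiv]
  simp
  ring

/-- for the spin-1/2 error dynamics with delayed feedback `u = k·x_d`
and measurement efficiency `η ∈ (0,1]`, on the boundary `Ψ(x) = 0` of the circular
domain one has `∇Ψ(x)ᵀ f(x, x_d) + ‖g(x)‖² ≤ 0`. -/
theorem spin_half_boundary_generator_nonpositive
    (k : ℝ × ℝ) (η : ℝ) (hη : 0 < η) (hη1 : η ≤ 1)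
    (f : ℝ × ℝ → ℝ × ℝ → ℝ × ℝ) (g : ℝ × ℝ → ℝ × ℝ) (Ψ : ℝ × ℝ → ℝ)
    (hf : ∀ x x_d : ℝ × ℝ, f x x_d =
      (-(k.1 * x_d.1 + k.2 * x_d.2) * x.2,
       (k.1 * x_d.1 + k.2 * x_d.2) * (x.1 - 1 / 2) - x.2 / 2))
    (hg : ∀ x : ℝ × ℝ, g x =
      (Real.sqrt η * (2 * x.1 * (x.1 - 1)), Real.sqrt η * ((2 * x.1 - 1) * x.2)))
    (hΨ : ∀ x : ℝ × ℝ, Ψ x = x.1 * (x.1 - 1) + x.2 ^ 2) :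
    ∀ x : ℝ × ℝ, Ψ x = 0 → ∀ x_d : ℝ × ℝ,
      fderiv ℝ Ψ x (f x x_d) + ((g x).1 ^ 2 + (g x).2 ^ 2) ≤ 0 := by
  intro x hx x_d
  obtain rfl : Ψ = fun p => p.1 * (p.1 - 1) + p.2 ^ 2 := funext hΨ
  have hx' : x.1 * (x.1 - 1) + x.2 ^ 2 = 0 := hx
  have hs : √η ^ 2 = η := Real.sq_sqrt hη.le
  have hg_sq : (g x).1 ^ 2 + (g x).2 ^ 2 = η * x.2 ^ 2 := by
    simp only [hg]
    linear_combination (4 * x.1 ^ 2 * (x.1 - 1) ^ 2 + (2 * x.1 - 1) ^ 2 * x.2 ^ 2) * hs +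
      η * 4 * x.1 * (x.1 - 1) * hx'
  have hdrift : fderiv ℝ (fun p : ℝ × ℝ => p.1 * (p.1 - 1) + p.2 ^ 2) x (f x x_d) =
      -x.2 ^ 2 := by
    rw [fderiv_circle_apply, hf]
    ring
  rw [hdrift, hg_sq]
  nlinarith [sq_nonneg x.2]
end

section
/- Let F_z := (1/2)·[[1,0],[0,−1]], ρ↑ := [[1,0],[0,0]], ρ↓ := [[0,0],[0,1]]. A 2×2 density matrix ρ (ρ = ρ*, ρ positive semidefinite, tr ρ = 1) satisfies both F_z(F_zρ − ρF_z) − (F_zρ − ρF_z)F_z = 0 and F_zρ + ρF_z − 2·tr(F_zρ)·ρ = 0 if and only if ρ = ρ↑ or ρ = ρ↓. -/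
open Matrix
open scoped ComplexOrder

/-- a 2×2 density matrix `ρ` satisfies both
`F_z(F_zρ − ρF_z) − (F_zρ − ρF_z)F_z = 0` and `F_zρ + ρF_z − 2 tr(F_zρ)·ρ = 0`
if and only if `ρ = ρ↑` or `ρ = ρ↓`. -/
theorem spin_half_equilibria_iff
    (ρ : Matrix (Fin 2) (Fin 2) ℂ)
    (hherm : ρᴴ = ρ) (hpsd : ρ.PosSemidef) (htr : ρ.trace = 1)
    (Fz : Matrix (Fin 2) (Fin 2) ℂ)
    (hFz : Fz = (1 / 2 : ℂ) • !![1, 0; 0, -1]) :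
    (Fz * (Fz * ρ - ρ * Fz) - (Fz * ρ - ρ * Fz) * Fz = 0 ∧
     Fz * ρ + ρ * Fz - (2 * (Fz * ρ).trace) • ρ = 0) ↔
    (ρ = !![(1 : ℂ), 0; 0, 0] ∨ ρ = !![(0 : ℂ), 0; 0, 1]) := by
  subst hFz
  constructor
  · rintro ⟨hdrift, hdiff⟩
    have h01 := congrFun (congrFun hdrift 0) 1
    have h10 := congrFun (congrFun hdrift 1) 0
    have h00 := congrFun (congrFun hdiff 0) 0
    simp [Matrix.mul_apply, Matrix.vecMul, dotProduct, Matrix.trace,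
      Fin.sum_univ_two] at h01 h10 h00 htr
    have hb : ρ 0 1 = 0 := by linear_combination h01
    have hc : ρ 1 0 = 0 := by linear_combination h10
    have had : ρ 0 0 * ρ 1 1 = 0 := by
      linear_combination (1 / 2 : ℂ) * h00 + (1 / 2 : ℂ) * ρ 0 0 * htr
    rcases mul_eq_zero.mp had with ha | hd
    · right
      have hd : ρ 1 1 = 1 := by linear_combination htr - ha
      ext i j
      fin_cases i <;> fin_cases j <;> simp [ha, hb, hc, hd]
    · left
      have ha : ρ 0 0 = 1 := by linear_combination htr - hd
      ext i j
      fin_cases i <;> fin_cases j <;> simp [ha, hb, hc, hd]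
  · rintro (rfl | rfl) <;> constructor <;> ext i j <;> fin_cases i <;> fin_cases j <;>
      norm_num [Matrix.mul_apply, Matrix.trace, Fin.sum_univ_two]
end
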